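/- For a > 0, S(a) = ∫_0^∞ (1/(e^{x/a} - 1)) · (1/2 + 1/(e^x - 1) - 1/x) dx, where S(a) = Σ_{n=1}^∞ [ln(n/a) - a/(2n) - ψ(n/a)]. -/

import Mathlib

open Real MeasureTheory

/-- The digamma function `ψ(x) = Γ'(x)/Γ(x) = d(log Γ)/dx`. -/
noncomputable def digamma (x : ℝ) : ℝ := deriv (fun y : ℝ => Real.log (Real.Gamma y)) x

/-- `S(a) = Σ_{n=1}^∞ [ln(n/a) - a/(2n) - ψ(n/a)]`. -/
noncomputable def S (a : ℝ) : ℝ :=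
  ∑' n : ℕ+, (Real.log ((n : ℝ) / a) - a / (2 * (n : ℝ)) - digamma ((n : ℝ) / a))

open Filter Topology Set

/-- The kernel `1/2 + 1/(e^t - 1) - 1/t` of Binet's integral for the digamma function. -/
noncomputable def binetKernel (t : ℝ) : ℝ := 1 / 2 + 1 / (Real.exp t - 1) - 1 / t

lemma measurable_binetKernel : Measurable binetKernel := by
  unfold binetKernel
  fun_prop

lemma exp_sub_one_pos {t : ℝ} (ht : 0 < t) : 0 < Real.exp t - 1 :=
  sub_pos.2 (Real.one_lt_exp_iff.2 ht)

lemma binetKernel_eq_div {t : ℝ} (ht : 0 < t) :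
    binetKernel t = ((t - 2) * Real.exp t + t + 2) / (2 * t * (Real.exp t - 1)) := by
  have h := (exp_sub_one_pos ht).ne'
  unfold binetKernel
  field_simp
  ring

lemma sub_two_mul_exp_add_nonneg {t : ℝ} (ht : 0 ≤ t) : 0 ≤ (t - 2) * Real.exp t + t + 2 := by
  have hd (s : ℝ) : HasDerivAt (fun s : ℝ ↦ (s - 2) * Real.exp s + s + 2)
      ((s - 1) * Real.exp s + 1) s := by
    refine ((((hasDerivAt_id s).sub_const 2).mul (Real.hasDerivAt_exp s)).add
      (hasDerivAt_id s)).add_const 2 |>.congr_deriv ?_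
    simp only [id]
    ring
  have hmono : Monotone fun s : ℝ ↦ (s - 2) * Real.exp s + s + 2 := by
    refine monotone_of_hasDerivAt_nonneg hd fun s ↦ ?_
    have h1 : 1 - s ≤ Real.exp (-s) := by linarith [Real.add_one_le_exp (-s)]
    have h2 := mul_le_mul_of_nonneg_right h1 (Real.exp_pos s).le
    rw [← Real.exp_add, neg_add_cancel, Real.exp_zero] at h2
    simp only [Pi.zero_apply]
    linarith
  simpa using hmono ht

lemma binetKernel_nonneg {t : ℝ} (ht : 0 < t) : 0 ≤ binetKernel t := by
  have h := exp_sub_one_pos ht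
  have := sub_two_mul_exp_add_nonneg ht.le
  rw [binetKernel_eq_div ht]
  positivity

lemma binetKernel_le_half {t : ℝ} (ht : 0 < t) : binetKernel t ≤ 1 / 2 := by
  have : 1 / (Real.exp t - 1) ≤ 1 / t :=
    one_div_le_one_div_of_le ht (by linarith [Real.add_one_le_exp t])
  unfold binetKernel
  linarith

lemma binetKernel_le_half_mul {t : ℝ} (ht : 0 < t) : binetKernel t ≤ t / 2 := by
  have h := exp_sub_one_pos ht
  have h2 := Real.quadratic_le_exp_of_nonneg ht.le
  rw [binetKernel_eq_div ht, div_le_iff₀ (by positivity)]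
  have h3 := mul_le_mul_of_nonneg_left h2 (show 0 ≤ t ^ 2 - t + 2 by nlinarith [sq_nonneg (t - 1)])
  nlinarith [pow_pos ht 3, pow_pos ht 4]

lemma integrableOn_exp_neg_mul {x : ℝ} (hx : 0 < x) :
    IntegrableOn (fun t ↦ Real.exp (-x * t)) (Ioi 0) :=
  integrableOn_exp_mul_Ioi (neg_neg_of_pos hx) 0

lemma integral_exp_neg_mul {x : ℝ} (hx : 0 < x) :
    ∫ t in Ioi 0, Real.exp (-x * t) = 1 / x := by
  rw [integral_exp_mul_Ioi (neg_neg_of_pos hx)]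
  simp [neg_div_neg_eq]

lemma integrableOn_exp_mul_binetKernel {x : ℝ} (hx : 0 < x) :
    IntegrableOn (fun t ↦ Real.exp (-x * t) * binetKernel t) (Ioi 0) := by
  refine Integrable.mono' ((integrableOn_exp_neg_mul hx).mul_const (1 / 2)) ?_ ?_
  · exact ((by fun_prop : Measurable fun t ↦ Real.exp (-x * t)).mul
      measurable_binetKernel).aestronglyMeasurable
  · filter_upwards [ae_restrict_mem measurableSet_Ioi] with t ht
    rw [Real.norm_of_nonneg (mul_nonneg (Real.exp_pos _).le (binetKernel_nonneg ht))]
    gcongr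
    exact binetKernel_le_half ht

lemma integral_exp_mul_binetKernel_nonneg (x : ℝ) :
    0 ≤ ∫ t in Ioi 0, Real.exp (-x * t) * binetKernel t :=
  setIntegral_nonneg measurableSet_Ioi fun _ ht ↦
    mul_nonneg (Real.exp_pos _).le (binetKernel_nonneg ht)

lemma integral_exp_mul_binetKernel_le {x : ℝ} (hx : 0 < x) :
    ∫ t in Ioi 0, Real.exp (-x * t) * binetKernel t ≤ 1 / (2 * x) := by
  calc _ ≤ ∫ t in Ioi 0, Real.exp (-x * t) * (1 / 2) := by
        refine setIntegral_mono_on (integrableOn_exp_mul_binetKernel hx)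
          ((integrableOn_exp_neg_mul hx).mul_const (1 / 2)) measurableSet_Ioi fun t ht ↦ ?_
        gcongr
        exact binetKernel_le_half ht
    _ = 1 / (2 * x) := by
        rw [integral_mul_const, integral_exp_neg_mul hx]
        field_simp

lemma integral_exp_mul_binetKernel_le_sq {x : ℝ} (hx : 0 < x) :
    ∫ t in Ioi 0, Real.exp (-x * t) * binetKernel t ≤ 1 / (2 * x ^ 2) := by
  have hint : IntegrableOn (fun t ↦ t * Real.exp (-x * t)) (Ioi 0) := by
    simpa using integrableOn_rpow_mul_exp_neg_mul_rpow (p := 1) (s := 1) (by norm_num) one_pos hx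
  have hval : ∫ t in Ioi 0, t * Real.exp (-x * t) = 1 / x ^ 2 := by
    have h := Real.integral_rpow_mul_exp_neg_mul_Ioi (a := 2) two_pos hx
    norm_num at h
    simpa using h
  calc _ ≤ ∫ t in Ioi 0, (t * Real.exp (-x * t)) * (1 / 2) := by
        refine setIntegral_mono_on (integrableOn_exp_mul_binetKernel hx)
          (hint.mul_const (1 / 2)) measurableSet_Ioi fun t ht ↦ ?_
        have := mul_le_mul_of_nonneg_left (binetKernel_le_half_mul ht) (Real.exp_pos (-x * t)).le
        linarith
    _ = 1 / (2 * x ^ 2) := by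
        rw [integral_mul_const, hval]
        field_simp

lemma exp_mul_binetKernel_sub {x t : ℝ} (ht : 0 < t) :
    t⁻¹ * (Real.exp (-(x * t)) - Real.exp (-((x + 1) * t))) =
      (Real.exp (-x * t) * (1 / 2) + Real.exp (-(x + 1) * t) * (1 / 2)) -
        (Real.exp (-x * t) * binetKernel t - Real.exp (-(x + 1) * t) * binetKernel t) := by
  have h := (exp_sub_one_pos ht).ne'
  have h1 : Real.exp (-x * t) = Real.exp (-(x + 1) * t) * Real.exp t := by
    rw [← Real.exp_add]
    ring_nf
  rw [← neg_mul, ← neg_mul, h1]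
  unfold binetKernel
  field_simp
  ring

lemma integral_exp_mul_binetKernel_sub {x : ℝ} (hx : 0 < x) :
    (∫ t in Ioi 0, Real.exp (-x * t) * binetKernel t) -
      ∫ t in Ioi 0, Real.exp (-(x + 1) * t) * binetKernel t =
    1 / (2 * x) + 1 / (2 * (x + 1)) - (Real.log (x + 1) - Real.log x) := by
  have hx1 : 0 < x + 1 := by positivity
  have i1 := (integrableOn_exp_neg_mul hx).mul_const (1 / 2)
  have i2 := (integrableOn_exp_neg_mul hx1).mul_const (1 / 2)
  have i3 := integrableOn_exp_mul_binetKernel hx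
  have i4 := integrableOn_exp_mul_binetKernel hx1
  have i12 : IntegrableOn (fun t ↦ Real.exp (-x * t) * (1 / 2) +
      Real.exp (-(x + 1) * t) * (1 / 2)) (Ioi 0) := i1.add i2
  have i34 : IntegrableOn (fun t ↦ Real.exp (-x * t) * binetKernel t -
      Real.exp (-(x + 1) * t) * binetKernel t) (Ioi 0) := i3.sub i4
  have hcongr : EqOn _ _ (Ioi (0 : ℝ)) := fun t ht ↦ exp_mul_binetKernel_sub (x := x) ht
  have hfrullani := Frullani.integral_Ioi_eq (f := fun t : ℝ ↦ Real.exp (-t)) (L := 1) (R := 0)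
    ((by fun_prop : Continuous fun t : ℝ ↦ Real.exp (-t)).locallyIntegrable.locallyIntegrableOn _)
    hx hx1
    (by
      have : Tendsto (fun t : ℝ ↦ Real.exp (-t)) (𝓝 0) (𝓝 (Real.exp (-0))) :=
        (by fun_prop : Continuous fun t : ℝ ↦ Real.exp (-t)).tendsto 0
      simpa using this.mono_left nhdsWithin_le_nhds)
    Real.tendsto_exp_neg_atTop_nhds_zero
    (IntegrableOn.congr_fun (i12.sub i34) hcongr.symm measurableSet_Ioi)
  simp only [smul_eq_mul] at hfrullani
  rw [setIntegral_congr_fun measurableSet_Ioi hcongr, integral_sub i12 i34,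
    integral_add i1 i2, integral_sub i3 i4, integral_mul_const, integral_mul_const,
    integral_exp_neg_mul hx, integral_exp_neg_mul hx1, Real.log_div hx1.ne' hx.ne'] at hfrullani
  have e1 : 1 / (2 * x) = 1 / x * (1 / 2) := by field_simp
  have e2 : 1 / (2 * (x + 1)) = 1 / (x + 1) * (1 / 2) := by field_simp
  rw [e1, e2]
  linarith

lemma differentiableAt_log_Gamma {x : ℝ} (hx : 0 < x) :
    DifferentiableAt ℝ (fun y ↦ Real.log (Real.Gamma y)) x :=
  (Real.differentiableAt_Gamma fun m ↦ by
    have : (0 : ℝ) ≤ m := m.cast_nonneg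
    linarith).log (Real.Gamma_pos_of_pos hx).ne'

lemma log_Gamma_add_one {x : ℝ} (hx : 0 < x) :
    Real.log (Real.Gamma (x + 1)) = Real.log (Real.Gamma x) + Real.log x := by
  rw [Real.Gamma_add_one hx.ne', Real.log_mul hx.ne' (Real.Gamma_pos_of_pos hx).ne', add_comm]

lemma digamma_add_one {x : ℝ} (hx : 0 < x) : digamma (x + 1) = digamma x + 1 / x := by
  unfold digamma
  rw [← deriv_comp_add_const (f := fun y ↦ Real.log (Real.Gamma y))]
  have : (fun y ↦ Real.log (Real.Gamma (y + 1))) =ᶠ[𝓝 x]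
      fun y ↦ Real.log (Real.Gamma y) + Real.log y := by
    filter_upwards [Ioi_mem_nhds hx] with y hy using log_Gamma_add_one hy
  rw [this.deriv_eq, deriv_fun_add (differentiableAt_log_Gamma hx)
    (Real.differentiableAt_log hx.ne'), Real.deriv_log, one_div]

lemma digamma_le_log {x : ℝ} (hx : 0 < x) : digamma x ≤ Real.log x := by
  have h := Real.convexOn_log_Gamma.deriv_le_slope (mem_Ioi.2 hx)
    (mem_Ioi.2 (by positivity : 0 < x + 1)) (lt_add_one x) (differentiableAt_log_Gamma hx)
  rw [slope_def_field, Function.comp_apply, Function.comp_apply, log_Gamma_add_one hx] at h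
  simpa [digamma, Function.comp_def] using h

lemma log_sub_inv_le_digamma {x : ℝ} (hx : 0 < x) : Real.log x - 1 / x ≤ digamma x := by
  have hx1 : 0 < x + 1 := by positivity
  have h := Real.convexOn_log_Gamma.slope_le_deriv (mem_Ioi.2 hx)
    (mem_Ioi.2 hx1) (lt_add_one x) (differentiableAt_log_Gamma hx1)
  rw [slope_def_field, Function.comp_apply, Function.comp_apply, log_Gamma_add_one hx] at h
  have hle : Real.log x ≤ digamma (x + 1) := by simpa [digamma, Function.comp_def] using h
  rw [digamma_add_one hx] at hle
  linarith

/-- A `1`-periodic function on `(0, ∞)` that is `O(1/x)` vanishes. -/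
lemma eq_zero_of_add_one_eq_of_abs_le {f : ℝ → ℝ} (hf : ∀ x, 0 < x → f (x + 1) = f x)
    (hb : ∀ x, 0 < x → |f x| ≤ 1 / x) {x : ℝ} (hx : 0 < x) : f x = 0 := by
  have hper (n : ℕ) : f (x + n) = f x := by
    induction n with
    | zero => simp
    | succ n ih => rw [Nat.cast_succ, ← add_assoc, hf _ (by positivity), ih]
  have hlim : Tendsto (fun n : ℕ ↦ 1 / (x + n)) atTop (𝓝 0) := by
    simp_rw [one_div]
    exact tendsto_inv_atTop_zero.comp
      (tendsto_atTop_add_const_left _ x tendsto_natCast_atTop_atTop)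
  refine abs_nonpos_iff.1 (ge_of_tendsto' hlim fun n ↦ ?_)
  rw [← hper n]
  exact hb _ (by positivity)

/-- **Binet's integral** for the digamma function. -/
lemma log_sub_inv_sub_digamma {x : ℝ} (hx : 0 < x) :
    Real.log x - 1 / (2 * x) - digamma x =
      ∫ t in Ioi 0, Real.exp (-x * t) * binetKernel t := by
  refine sub_eq_zero.1 (eq_zero_of_add_one_eq_of_abs_le
    (f := fun x ↦ Real.log x - 1 / (2 * x) - digamma x -
      ∫ t in Ioi 0, Real.exp (-x * t) * binetKernel t) (fun y hy ↦ ?_) (fun y hy ↦ ?_) hx)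
  · have h := integral_exp_mul_binetKernel_sub hy
    have e : 1 / (2 * y) = 1 / y * (1 / 2) := by field_simp
    have hd := digamma_add_one hy
    simp only [e] at h ⊢
    linarith
  · have e : 1 / (2 * y) = 1 / y * (1 / 2) := by field_simp
    have h0 := integral_exp_mul_binetKernel_nonneg y
    have h1 := integral_exp_mul_binetKernel_le hy
    have h2 := digamma_le_log hy
    have h3 := log_sub_inv_le_digamma hy
    rw [e] at h1
    simp only [e]
    rw [abs_le]
    constructor <;> linarith

lemma tsum_pnat_exp_neg_mul {y : ℝ} (hy : 0 < y) :
    ∑' n : ℕ+, Real.exp (-(n * y)) = 1 / (Real.exp y - 1) := by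
  have hpow (n : ℕ) : Real.exp (-((n + 1 : ℕ) * y)) = Real.exp (-y) * Real.exp (-y) ^ n := by
    rw [← Real.exp_nat_mul, ← Real.exp_add]
    push_cast
    ring_nf
  have h := (exp_sub_one_pos hy).ne'
  rw [tsum_pnat_eq_tsum_succ (f := fun n : ℕ ↦ Real.exp (-(n * y)))]
  simp_rw [hpow]
  rw [tsum_mul_left, tsum_geometric_of_lt_one (Real.exp_pos _).le
    (Real.exp_lt_one_iff.2 (neg_neg_of_pos hy)), Real.exp_neg]
  have hne : 1 - (Real.exp y)⁻¹ ≠ 0 := by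
    rw [← Real.exp_neg]
    exact (sub_pos.2 (Real.exp_lt_one_iff.2 (neg_neg_of_pos hy))).ne'
  field_simp

theorem S_integral_representation (a : ℝ) (ha : 0 < a) :
    S a = ∫ x in Set.Ioi (0 : ℝ),
      (1 / (Real.exp (x / a) - 1)) * (1 / 2 + 1 / (Real.exp x - 1) - 1 / x) := by
  have hpos (n : ℕ+) : 0 < (n : ℝ) / a := div_pos (by exact_mod_cast n.pos) ha
  have hnorm (n : ℕ+) : ∫ x in Ioi 0, ‖Real.exp (-((n : ℝ) / a) * x) * binetKernel x‖ =
      ∫ x in Ioi 0, Real.exp (-((n : ℝ) / a) * x) * binetKernel x :=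
    setIntegral_congr_fun measurableSet_Ioi fun x hx ↦
      Real.norm_of_nonneg (mul_nonneg (Real.exp_pos _).le (binetKernel_nonneg hx))
  have hsum : Summable fun n : ℕ+ ↦
      ∫ x in Ioi 0, ‖Real.exp (-((n : ℝ) / a) * x) * binetKernel x‖ := by
    simp_rw [hnorm]
    have hs : Summable fun n : ℕ+ ↦ 1 / (2 * ((n : ℝ) / a) ^ 2) := by
      have := ((Real.summable_one_div_nat_pow.2 one_lt_two).comp_injective
        PNat.coe_injective).mul_left (a ^ 2 / 2)
      refine this.congr fun n ↦ ?_
      have := n.ne_zero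
      simp only [Function.comp_apply]
      field_simp
    exact hs.of_nonneg_of_le (fun n ↦ integral_exp_mul_binetKernel_nonneg _)
      fun n ↦ integral_exp_mul_binetKernel_le_sq (hpos n)
  have key := hasSum_integral_of_summable_integral_norm
    (fun n : ℕ+ ↦ integrableOn_exp_mul_binetKernel (hpos n)) hsum
  calc S a = ∑' n : ℕ+, ∫ x in Ioi 0, Real.exp (-((n : ℝ) / a) * x) * binetKernel x := by
        refine tsum_congr fun n ↦ ?_
        rw [← log_sub_inv_sub_digamma (hpos n)]
        congr 2
        field_simp
    _ = ∫ x in Ioi 0, ∑' n : ℕ+, Real.exp (-((n : ℝ) / a) * x) * binetKernel x := key.tsum_eq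
    _ = _ := by
        refine setIntegral_congr_fun measurableSet_Ioi fun x hx ↦ ?_
        rw [tsum_mul_right, ← tsum_pnat_exp_neg_mul (div_pos hx ha)]
        congr 1
        exact tsum_congr fun n ↦ by ring_nf
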